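/- arXiv:2305.17751 — 7 statements merged into one kernel-verified Lean document; each statement's English description precedes it below -/
import Mathlib

section
/- Let s be a vector in Euclidean space ℝ³ and let k ∈ ℝ³ be a unit vector. Then the error of the Fresnel (second-order) approximation of the propagation distance satisfies: the function r ↦ ‖r•k − s‖ − ( r − ⟪k, s⟫ + (‖s‖² − ⟪k, s⟫²)/(2r) ) is O(r⁻²) as r → ∞ (big-O along the filter atTop on ℝ). -/
open scoped RealInnerProductSpace

/-- The error of the Fresnel (second-order) approximation of the propagation distance
`‖r • k - s‖` is `O(r⁻²)` as `r → ∞`, where `k` is the unit propagation-direction vector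
and `s` the position of the transmit antenna element. -/
theorem fresnel_approximation_isBigO (s k : EuclideanSpace ℝ (Fin 3)) (hk : ‖k‖ = 1) :
    (fun r : ℝ =>
        ‖r • k - s‖ - (r - ⟪k, s⟫ + (‖s‖ ^ 2 - ⟪k, s⟫ ^ 2) / (2 * r)))
      =O[Filter.atTop] (fun r : ℝ => r⁻¹ ^ 2) := by
  have hc : 0 ≤ ‖s‖ ^ 2 - ⟪k, s⟫ ^ 2 := by
    have h := abs_real_inner_le_norm k s
    rw [hk, one_mul] at h
    exact sub_nonneg.mpr (sq_le_sq.mpr (by rwa [abs_norm]))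
  have hN (r : ℝ) : ‖r • k - s‖ ^ 2 = r ^ 2 - 2 * r * ⟪k, s⟫ + ‖s‖ ^ 2 := by
    rw [norm_sub_sq_real, norm_smul, hk, real_inner_smul_left, mul_one, Real.norm_eq_abs, sq_abs]
    ring
  set a : ℝ := ⟪k, s⟫
  set c : ℝ := ‖s‖ ^ 2 - a ^ 2 with hc_def
  refine Asymptotics.IsBigO.of_bound (2 * (|a| * c + c ^ 2 / 4)) ?_
  filter_upwards [Filter.eventually_ge_atTop (1 : ℝ), Filter.eventually_ge_atTop (2 * |a|)]
    with r hr1 hra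
  have hr : 0 < r := by linarith
  set F : ℝ := r - a + c / (2 * r) with hF
  have hF_ge : r / 2 ≤ ‖r • k - s‖ + F := by
    have : 0 ≤ c / (2 * r) := by positivity
    linarith [le_abs_self a, norm_nonneg (r • k - s)]
  have h_diff : (‖r • k - s‖ - F) * (‖r • k - s‖ + F) = (a * c - c ^ 2 / 4 * r⁻¹) * r⁻¹ := by
    have h : (‖r • k - s‖ - F) * (‖r • k - s‖ + F) = ‖r • k - s‖ ^ 2 - F ^ 2 := by ring
    rw [h, hN, hF, show ‖s‖ ^ 2 = c + a ^ 2 by rw [hc_def]; ring]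
    field_simp
    ring
  have h_num : |a * c - c ^ 2 / 4 * r⁻¹| ≤ |a| * c + c ^ 2 / 4 := by
    refine (abs_sub _ _).trans (add_le_add ?_ ?_)
    · rw [abs_mul, abs_of_nonneg hc]
    · rw [abs_of_nonneg (by positivity)]
      exact mul_le_of_le_one_right (by positivity) (inv_le_one_of_one_le₀ hr1)
  have h_mul : |‖r • k - s‖ - F| * (r / 2) ≤ (|a| * c + c ^ 2 / 4) * r⁻¹ :=
    calc |‖r • k - s‖ - F| * (r / 2)
        ≤ |‖r • k - s‖ - F| * |‖r • k - s‖ + F| := by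
          gcongr
          exact hF_ge.trans (le_abs_self _)
      _ = |a * c - c ^ 2 / 4 * r⁻¹| * r⁻¹ := by
          rw [← abs_mul, h_diff, abs_mul, abs_of_pos (inv_pos.mpr hr)]
      _ ≤ _ := by gcongr
  rw [Real.norm_eq_abs, Real.norm_of_nonneg (by positivity)]
  calc |‖r • k - s‖ - F| = |‖r • k - s‖ - F| * (r / 2) * (2 * r⁻¹) := by field_simp
    _ ≤ (|a| * c + c ^ 2 / 4) * r⁻¹ * (2 * r⁻¹) := by gcongr
    _ = _ := by ring
end

section
/- For every Ψ > 0 and all a, b > 0, the double integral of (Ψ² + x² + z²)^{-1} over the rectangle [−a, a] × [−b, b] is squeezed strictly between the corresponding integrals over the inscribed and circumscribed disks: π·ln(1 + (min(a,b))²/Ψ²) < ∫_{−b}^{b} ∫_{−a}^{a} (Ψ² + x² + z²)^{-1} dx dz < π·ln(1 + (a² + b²)/Ψ²). -/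
open MeasureTheory Set in
/-- Integrating a positive function over a set that is larger by a non-null set gives a strictly
larger value. -/
theorem setIntegral_lt_setIntegral_of_diff_pos {α : Type*} [MeasurableSpace α] {μ : Measure α}
    {f : α → ℝ} {s t : Set α} (hs : MeasurableSet s) (hst : s ⊆ t)
    (hf : ∀ x, 0 < f x) (hfi : IntegrableOn f t μ) (hμ : 0 < μ (t \ s)) :
    ∫ x in s, f x ∂μ < ∫ x in t, f x ∂μ := by
  have hdiff := setIntegral_sdiff (μ := μ) hs hfi hst
  have hpos : 0 < ∫ x in t \ s, f x ∂μ := by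
    rw [setIntegral_pos_iff_support_of_nonneg_ae
      (Filter.Eventually.of_forall fun x => (hf x).le) (hfi.mono_set sdiff_subset)]
    have hsupp : Function.support f = univ := by
      ext x
      simp [(hf x).ne']
    rwa [hsupp, univ_inter]
  linarith

theorem integral_mul_inv_sq_add_sq (Ψ R : ℝ) (hΨ : 0 < Ψ) :
    ∫ r in (0 : ℝ)..R, r * (Ψ ^ 2 + r ^ 2)⁻¹ = Real.log (1 + R ^ 2 / Ψ ^ 2) / 2 := by
  have hne (r : ℝ) : Ψ ^ 2 + r ^ 2 ≠ 0 := by positivity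
  have hderiv (r : ℝ) : HasDerivAt (fun r : ℝ => Real.log (Ψ ^ 2 + r ^ 2) / 2)
      (r * (Ψ ^ 2 + r ^ 2)⁻¹) r := by
    have h := (((hasDerivAt_pow 2 r).const_add (Ψ ^ 2)).log (hne r)).div_const 2
    refine h.congr_deriv ?_
    have := hne r
    simp only [Nat.cast_ofNat, Nat.add_one_sub_one, pow_one]
    field_simp
  rw [intervalIntegral.integral_eq_sub_of_hasDerivAt (fun r _ => hderiv r)
    (Continuous.intervalIntegrable (by fun_prop (disch := exact hne _)) _ _)]
  have h : 1 + R ^ 2 / Ψ ^ 2 = (Ψ ^ 2 + R ^ 2) / Ψ ^ 2 := by field_simp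
  rw [h, Real.log_div (hne R) (by positivity)]
  simp
  ring

open MeasureTheory Set in
theorem setIntegral_disk_inv_sq_add_sq (Ψ R : ℝ) (hΨ : 0 < Ψ) (hR : 0 ≤ R) :
    ∫ p in {p : ℝ × ℝ | p.1 ^ 2 + p.2 ^ 2 ≤ R ^ 2}, (Ψ ^ 2 + p.2 ^ 2 + p.1 ^ 2)⁻¹ =
      Real.pi * Real.log (1 + R ^ 2 / Ψ ^ 2) := by
  have hD : MeasurableSet {p : ℝ × ℝ | p.1 ^ 2 + p.2 ^ 2 ≤ R ^ 2} :=
    (isClosed_le (by fun_prop) (by fun_prop)).measurableSet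
  rw [← integral_indicator hD, ← integral_comp_polarCoord_symm]
  have hT : MeasurableSet polarCoord.target := polarCoord.open_target.measurableSet
  have hcongr : ∀ p ∈ polarCoord.target,
      p.1 • indicator {p : ℝ × ℝ | p.1 ^ 2 + p.2 ^ 2 ≤ R ^ 2}
        (fun p : ℝ × ℝ => (Ψ ^ 2 + p.2 ^ 2 + p.1 ^ 2)⁻¹) (polarCoord.symm p) =
      (Iic R).indicator (fun r : ℝ => r * (Ψ ^ 2 + r ^ 2)⁻¹) p.1 * (fun _ : ℝ => (1 : ℝ)) p.2 := by
    rintro ⟨r, θ⟩ hp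
    have hr : 0 < r := by simpa using hp.1
    have h1 : (r * Real.cos θ) ^ 2 + (r * Real.sin θ) ^ 2 = r ^ 2 := by
      linear_combination r ^ 2 * Real.sin_sq_add_cos_sq θ
    have h2 : Ψ ^ 2 + (r * Real.sin θ) ^ 2 + (r * Real.cos θ) ^ 2 = Ψ ^ 2 + r ^ 2 := by
      linear_combination h1
    simp only [polarCoord_symm_apply, indicator_apply, mem_ofPred_eq, mem_Iic, h1, h2,
      pow_le_pow_iff_left₀ hr.le hR two_ne_zero, smul_eq_mul, mul_one, mul_ite, mul_zero]
  rw [setIntegral_congr_fun hT hcongr, polarCoord_target, Measure.volume_eq_prod,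
    setIntegral_prod_mul ((Iic R).indicator fun r : ℝ => r * (Ψ ^ 2 + r ^ 2)⁻¹) fun _ => (1 : ℝ),
    setIntegral_indicator measurableSet_Iic, Ioi_inter_Iic,
    ← intervalIntegral.integral_of_le hR, integral_mul_inv_sq_add_sq Ψ R hΨ]
  have hpi : (-Real.pi) ≤ Real.pi := by linarith [Real.pi_pos]
  rw [← integral_Ioc_eq_integral_Ioo, ← intervalIntegral.integral_of_le hpi]
  simp
  ring

open MeasureTheory Set in
theorem intervalIntegral_intervalIntegral_eq_setIntegral_Icc_prod {f : ℝ × ℝ → ℝ}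
    (hf : Continuous f) {a b : ℝ} (ha : 0 ≤ a) (hb : 0 ≤ b) :
    ∫ z in (-b)..b, ∫ x in (-a)..a, f (z, x) = ∫ p in Icc (-b) b ×ˢ Icc (-a) a, f p := by
  rw [Measure.volume_eq_prod, setIntegral_prod _
    (hf.continuousOn.integrableOn_compact (isCompact_Icc.prod isCompact_Icc)),
    intervalIntegral.integral_of_le (by linarith), integral_Icc_eq_integral_Ioc]
  simp only [intervalIntegral.integral_of_le (neg_le_self ha), integral_Icc_eq_integral_Ioc]

/-- The double integral of `(Ψ² + x² + z²)⁻¹` over the rectangle `[−a,a] × [−b,b]` is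
squeezed strictly between the corresponding integrals over the inscribed disk (radius
`min a b`) and the circumscribed disk (radius `√(a² + b²)`). -/
theorem rectangle_integral_squeeze (Ψ a b : ℝ) (hΨ : 0 < Ψ) (ha : 0 < a) (hb : 0 < b) :
    Real.pi * Real.log (1 + (min a b) ^ 2 / Ψ ^ 2) <
      (∫ z in (-b)..b, ∫ x in (-a)..a, (Ψ ^ 2 + x ^ 2 + z ^ 2)⁻¹) ∧
    (∫ z in (-b)..b, ∫ x in (-a)..a, (Ψ ^ 2 + x ^ 2 + z ^ 2)⁻¹) <
      Real.pi * Real.log (1 + (a ^ 2 + b ^ 2) / Ψ ^ 2) := by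
  have hpos (p : ℝ × ℝ) : 0 < (Ψ ^ 2 + p.2 ^ 2 + p.1 ^ 2)⁻¹ := by positivity
  have hcont : Continuous fun p : ℝ × ℝ => (Ψ ^ 2 + p.2 ^ 2 + p.1 ^ 2)⁻¹ :=
    Continuous.inv₀ (by fun_prop) fun p => by positivity
  have hclosed (R : ℝ) : IsClosed {p : ℝ × ℝ | p.1 ^ 2 + p.2 ^ 2 ≤ R ^ 2} :=
    isClosed_le (by fun_prop) (by fun_prop)
  have hrect : IsCompact (Set.Icc (-b) b ×ˢ Set.Icc (-a) a) := isCompact_Icc.prod isCompact_Icc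
  have hm : 0 < min a b := lt_min ha hb
  have hsq : √(a ^ 2 + b ^ 2) ^ 2 = a ^ 2 + b ^ 2 := Real.sq_sqrt (by positivity)
  rw [intervalIntegral_intervalIntegral_eq_setIntegral_Icc_prod hcont ha.le hb.le,
    ← setIntegral_disk_inv_sq_add_sq Ψ _ hΨ hm.le, ← hsq,
    ← setIntegral_disk_inv_sq_add_sq Ψ _ hΨ (Real.sqrt_nonneg _)]
  constructor
  · refine setIntegral_lt_setIntegral_of_diff_pos (hclosed _).measurableSet
      ?_ hpos (hcont.continuousOn.integrableOn_compact hrect) ?_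
    · rintro ⟨z, x⟩ h
      simp only [Set.mem_ofPred_eq] at h
      have hz := abs_le_of_sq_le_sq' (show z ^ 2 ≤ min a b ^ 2 by nlinarith) hm.le
      have hx := abs_le_of_sq_le_sq' (show x ^ 2 ≤ min a b ^ 2 by nlinarith) hm.le
      have h1 := min_le_left a b
      have h2 := min_le_right a b
      simp only [Set.mem_prod, Set.mem_Icc]
      refine ⟨⟨?_, ?_⟩, ?_, ?_⟩ <;> linarith
    · refine lt_of_lt_of_le (IsOpen.measure_pos MeasureTheory.volume
        (U := (Set.Ioo (-b) b ×ˢ Set.Ioo (-a) a) \ {p : ℝ × ℝ | p.1 ^ 2 + p.2 ^ 2 ≤ min a b ^ 2})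
        ((isOpen_Ioo.prod isOpen_Ioo).sdiff (hclosed _)) ⟨(4 / 5 * b, 4 / 5 * a), ?_⟩)
        (MeasureTheory.measure_mono (Set.sdiff_subset_sdiff_left
          (Set.prod_mono Set.Ioo_subset_Icc_self Set.Ioo_subset_Icc_self)))
      have h1 : min a b ^ 2 ≤ a ^ 2 := pow_le_pow_left₀ hm.le (min_le_left a b) 2
      have h2 : min a b ^ 2 ≤ b ^ 2 := pow_le_pow_left₀ hm.le (min_le_right a b) 2
      simp only [Set.mem_sdiff, Set.mem_prod, Set.mem_Ioo, Set.mem_ofPred_eq, not_le]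
      refine ⟨⟨⟨?_, ?_⟩, ?_, ?_⟩, ?_⟩
      iterate 4 linarith
      nlinarith
  · have hdisk : IsCompact {p : ℝ × ℝ | p.1 ^ 2 + p.2 ^ 2 ≤ √(a ^ 2 + b ^ 2) ^ 2} := by
      refine (isCompact_Icc (a := -√(a ^ 2 + b ^ 2)) (b := √(a ^ 2 + b ^ 2))).prod
        (isCompact_Icc (a := -√(a ^ 2 + b ^ 2)) (b := √(a ^ 2 + b ^ 2)))
        |>.of_isClosed_subset (hclosed _) ?_
      rintro ⟨z, x⟩ h
      simp only [Set.mem_ofPred_eq] at h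
      exact ⟨abs_le_of_sq_le_sq' (by nlinarith) (Real.sqrt_nonneg _),
        abs_le_of_sq_le_sq' (by nlinarith) (Real.sqrt_nonneg _)⟩
    refine setIntegral_lt_setIntegral_of_diff_pos hrect.measurableSet
      ?_ hpos (hcont.continuousOn.integrableOn_compact hdisk) ?_
    · rintro ⟨z, x⟩ ⟨⟨h1, h2⟩, h3, h4⟩
      simp only at h1 h2 h3 h4
      simp only [Set.mem_ofPred_eq, hsq]
      nlinarith
    · have hlt : b < √(a ^ 2 + b ^ 2) := Real.lt_sqrt_of_sq_lt (by nlinarith)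
      obtain ⟨c, hbc, hc⟩ := exists_between hlt
      have hopen : IsOpen {p : ℝ × ℝ | p.1 ^ 2 + p.2 ^ 2 < √(a ^ 2 + b ^ 2) ^ 2} :=
        isOpen_lt (by fun_prop) (by fun_prop)
      refine lt_of_lt_of_le (IsOpen.measure_pos MeasureTheory.volume
        (hopen.sdiff hrect.isClosed) ⟨(c, 0), ?_, ?_⟩)
        (MeasureTheory.measure_mono (Set.sdiff_subset_sdiff_left fun p hp => by
          simp only [Set.mem_ofPred_eq] at hp ⊢
          exact hp.le))
      · simp only [Set.mem_ofPred_eq]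
        nlinarith
      · rintro ⟨⟨-, h⟩, -⟩
        exact absurd h (not_le.mpr hbc)
end

section
/- For every Ψ > 0, the function I(a) = ∫_{−a}^{a} ∫_{−a}^{a} (Ψ² + x² + z²)^{-1} dx dz satisfies lim_{a→∞} I(a)/ln a = 2π. In particular, the received SNR of a continuous-aperture transmitter of side length L_x = L_z = 2a under the NUSW near-field channel model, which is proportional to I(a), grows logarithmically (and hence unboundedly) in the aperture area. -/
open intervalIntegral in
/-- The antiderivative of `(c² + x²)⁻¹` evaluated between symmetric endpoints. -/
theorem integral_inv_sq_add_sq_symm (c a : ℝ) (hc : 0 < c) :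
    ∫ x in (-a)..a, (c ^ 2 + x ^ 2)⁻¹ = 2 * Real.arctan (a / c) / c := by
  have hderiv : ∀ x ∈ Set.uIcc (-a) a,
      HasDerivAt (fun x : ℝ => Real.arctan (x / c) / c) (c ^ 2 + x ^ 2)⁻¹ x := by
    intro x _
    refine (((hasDerivAt_id x).div_const c).arctan.div_const c).congr_deriv ?_
    have : c ^ 2 + x ^ 2 ≠ 0 := by positivity
    simp only [id]
    field_simp
  have hcont : Continuous (fun x : ℝ => (c ^ 2 + x ^ 2)⁻¹) :=
    Continuous.inv₀ (by fun_prop) fun x => by positivity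
  rw [integral_eq_sub_of_hasDerivAt hderiv (hcont.intervalIntegrable _ _), neg_div,
    Real.arctan_neg]
  ring

theorem continuous_inv_mul_sqrt_one_add_div_sq (Ψ : ℝ) (hΨ : 0 < Ψ) :
    Continuous (fun z : ℝ => (Ψ * Real.sqrt (1 + (z / Ψ) ^ 2))⁻¹) :=
  Continuous.inv₀ (by fun_prop) fun z => by positivity

open intervalIntegral in
theorem integral_inv_mul_sqrt_one_add_div_sq_symm (Ψ a : ℝ) (hΨ : 0 < Ψ) :
    ∫ z in (-a)..a, (Ψ * Real.sqrt (1 + (z / Ψ) ^ 2))⁻¹ = 2 * Real.arsinh (a / Ψ) := by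
  have hderiv : ∀ z ∈ Set.uIcc (-a) a, HasDerivAt (fun z : ℝ => Real.arsinh (z / Ψ))
      (Ψ * Real.sqrt (1 + (z / Ψ) ^ 2))⁻¹ z := by
    intro z _
    refine (((hasDerivAt_id z).div_const Ψ).arsinh).congr_deriv ?_
    simp only [id, smul_eq_mul]
    rw [mul_inv]
    ring
  rw [integral_eq_sub_of_hasDerivAt hderiv
    ((continuous_inv_mul_sqrt_one_add_div_sq Ψ hΨ).intervalIntegrable _ _), neg_div,
    Real.arsinh_neg]
  ring

theorem pi_div_two_sub_inv_le_arctan {t : ℝ} (ht : 0 < t) :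
    Real.pi / 2 - t⁻¹ ≤ Real.arctan t := by
  have h := Real.arctan_inv_of_pos ht
  have h' : Real.arctan t⁻¹ ≤ t⁻¹ := by
    have hpos : 0 ≤ Real.arctan t⁻¹ := Real.arctan_nonneg.2 (by positivity)
    simpa [Real.tan_arctan] using Real.le_tan hpos (Real.arctan_lt_pi_div_two _)
  linarith

theorem log_le_arsinh {y : ℝ} (hy : 0 < y) : Real.log y ≤ Real.arsinh y :=
  Real.log_le_log hy (le_add_of_nonneg_right (Real.sqrt_nonneg _))

theorem arsinh_le_log_three_mul {y : ℝ} (hy : 1 ≤ y) :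
    Real.arsinh y ≤ Real.log (3 * y) := by
  have h : Real.sqrt (1 + y ^ 2) ≤ 2 * y := Real.sqrt_le_iff.2 ⟨by linarith, by nlinarith⟩
  have := Real.sqrt_nonneg (1 + y ^ 2)
  exact Real.log_le_log (by linarith) (by linarith)

open intervalIntegral in
/-- The square-aperture integral agrees with `2π arsinh (a / Ψ)` up to a bounded error. -/
theorem square_aperture_integral_bounds (Ψ a : ℝ) (hΨ : 0 < Ψ) (ha : 0 < a) :
    2 * Real.pi * Real.arsinh (a / Ψ) - 4 ≤
        ∫ z in (-a)..a, ∫ x in (-a)..a, (Ψ ^ 2 + x ^ 2 + z ^ 2)⁻¹ ∧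
      ∫ z in (-a)..a, ∫ x in (-a)..a, (Ψ ^ 2 + x ^ 2 + z ^ 2)⁻¹ ≤
        2 * Real.pi * Real.arsinh (a / Ψ) := by
  set c : ℝ → ℝ := fun z => Ψ * Real.sqrt (1 + (z / Ψ) ^ 2) with hc
  have hcpos : ∀ z, 0 < c z := fun z => by simp only [hc]; positivity
  have hcsq : ∀ z, c z ^ 2 = Ψ ^ 2 + z ^ 2 := fun z => by
    simp only [hc]
    rw [mul_pow, Real.sq_sqrt (by positivity)]
    field_simp
  have hinner : ∀ z, ∫ x in (-a)..a, (Ψ ^ 2 + x ^ 2 + z ^ 2)⁻¹ =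
      2 * Real.arctan (a / c z) / c z := fun z => by
    rw [← integral_inv_sq_add_sq_symm _ _ (hcpos z), hcsq]
    simp only [add_right_comm]
  simp only [hinner]
  have hcc : Continuous c := by simp only [hc]; fun_prop
  have hinv : Continuous (fun z => (c z)⁻¹) := continuous_inv_mul_sqrt_one_add_div_sq Ψ hΨ
  have hint : ∫ z in (-a)..a, (c z)⁻¹ = 2 * Real.arsinh (a / Ψ) :=
    integral_inv_mul_sqrt_one_add_div_sq_symm Ψ a hΨ
  have hF : Continuous (fun z => 2 * Real.arctan (a / c z) / c z) :=
    ((Real.continuous_arctan.comp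
      (continuous_const.div hcc fun z => (hcpos z).ne')).const_mul 2).div hcc
      fun z => (hcpos z).ne'
  have hle : -a ≤ a := by linarith
  constructor
  · have hlow : ∫ z in (-a)..a, (Real.pi * (c z)⁻¹ - 2 / a) =
        2 * Real.pi * Real.arsinh (a / Ψ) - 4 := by
      rw [integral_sub ((hinv.const_mul _).intervalIntegrable _ _) (by simp),
        integral_const_mul, hint, integral_const, smul_eq_mul]
      field_simp
      ring
    rw [← hlow]
    refine integral_mono_on hle (((hinv.const_mul _).sub continuous_const).intervalIntegrable _ _)
      (hF.intervalIntegrable _ _) fun z _ => ?_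
    have hz := hcpos z
    have h := pi_div_two_sub_inv_le_arctan (div_pos ha hz)
    have h2 : 2 * (Real.pi / 2 - (a / c z)⁻¹) / c z ≤ 2 * Real.arctan (a / c z) / c z := by
      gcongr
    refine le_trans (le_of_eq ?_) h2
    field_simp
  · have hup : ∫ z in (-a)..a, Real.pi * (c z)⁻¹ = 2 * Real.pi * Real.arsinh (a / Ψ) := by
      rw [integral_const_mul, hint]
      ring
    rw [← hup]
    refine integral_mono_on hle (hF.intervalIntegrable _ _)
      ((hinv.const_mul _).intervalIntegrable _ _) fun z _ => ?_
    have hz := hcpos z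
    rw [← div_eq_mul_inv]
    have := (Real.arctan_lt_pi_div_two (a / c z)).le
    gcongr
    linarith

theorem tendsto_mul_log_add_const_div_log (k b : ℝ) :
    Filter.Tendsto (fun a : ℝ => (k * Real.log a + b) / Real.log a) Filter.atTop (nhds k) := by
  have h : Filter.Tendsto (fun a : ℝ => k + b / Real.log a) Filter.atTop (nhds (k + 0)) :=
    tendsto_const_nhds.add (Real.tendsto_log_atTop.const_div_atTop b)
  rw [add_zero] at h
  refine h.congr' ?_
  filter_upwards [Filter.eventually_gt_atTop 1] with a ha
  have := (Real.log_pos ha).ne'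
  field_simp

/-- Logarithmic power-scaling law under the NUSW model for a continuous-aperture square
transmitter: the integral `I(a) = ∫_{−a}^{a} ∫_{−a}^{a} (Ψ² + x² + z²)⁻¹ dx dz` satisfies
`I(a) / ln a → 2π` as `a → ∞`, hence grows logarithmically (and unboundedly). -/
theorem nusw_cap_log_scaling (Ψ : ℝ) (hΨ : 0 < Ψ) :
    Filter.Tendsto
      (fun a : ℝ =>
        (∫ z in (-a)..a, ∫ x in (-a)..a, (Ψ ^ 2 + x ^ 2 + z ^ 2)⁻¹) / Real.log a)
      Filter.atTop (nhds (2 * Real.pi)) := by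
  refine tendsto_of_tendsto_of_tendsto_of_le_of_le'
    (tendsto_mul_log_add_const_div_log (2 * Real.pi) (-(2 * Real.pi * Real.log Ψ) - 4))
    (tendsto_mul_log_add_const_div_log (2 * Real.pi)
      (2 * Real.pi * (Real.log 3 - Real.log Ψ))) ?_ ?_
  · filter_upwards [Filter.eventually_gt_atTop 1] with a ha
    have ha0 : 0 < a := by linarith
    have hlog := Real.log_pos ha
    have h := (square_aperture_integral_bounds Ψ a hΨ ha0).1
    have h' := mul_le_mul_of_nonneg_left (log_le_arsinh (div_pos ha0 hΨ)) Real.two_pi_pos.le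
    rw [Real.log_div ha0.ne' hΨ.ne'] at h'
    gcongr
    linarith
  · filter_upwards [Filter.eventually_gt_atTop 1, Filter.eventually_ge_atTop Ψ] with a ha haΨ
    have ha0 : 0 < a := by linarith
    have hlog := Real.log_pos ha
    have h := (square_aperture_integral_bounds Ψ a hΨ ha0).2
    have h' := mul_le_mul_of_nonneg_left (arsinh_le_log_three_mul ((one_le_div hΨ).2 haΨ))
      Real.two_pi_pos.le
    rw [Real.log_mul three_ne_zero (div_pos ha0 hΨ).ne', Real.log_div ha0.ne' hΨ.ne'] at h'
    gcongr
    linarith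
end

section
/- Let Ψ > 0 and define F_Ψ(x, z) = Ψxz/( 3(Ψ² + x²)·√(Ψ² + x² + z²) ) + (2/3)·arctan( xz/( Ψ·√(Ψ² + x² + z²) ) ). Then for all real numbers x₁ ≤ x₂ and z₁ ≤ z₂: ∫_{z₁}^{z₂} ∫_{x₁}^{x₂} Ψ(Ψ² + z²)/(Ψ² + x² + z²)^{5/2} dx dz = F_Ψ(x₂, z₂) − F_Ψ(x₁, z₂) − F_Ψ(x₂, z₁) + F_Ψ(x₁, z₁). -/
/-- The antiderivative `F_Ψ` appearing in the closed-form received SNR of the general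
near-field channel model. -/
noncomputable def generalModelF (Ψ x z : ℝ) : ℝ :=
  Ψ * x * z / (3 * (Ψ ^ 2 + x ^ 2) * Real.sqrt (Ψ ^ 2 + x ^ 2 + z ^ 2)) +
    (2 / 3) * Real.arctan (x * z / (Ψ * Real.sqrt (Ψ ^ 2 + x ^ 2 + z ^ 2)))

/-- The antiderivative in `x` of the integrand of the general near-field channel model. -/
noncomputable def generalModelInner (Ψ x z : ℝ) : ℝ :=
  Ψ * x / (3 * Real.sqrt (Ψ ^ 2 + x ^ 2 + z ^ 2) ^ 3) +
    2 * Ψ * x / (3 * (Ψ ^ 2 + z ^ 2) * Real.sqrt (Ψ ^ 2 + x ^ 2 + z ^ 2))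

lemma rpow_five_halves_eq_sqrt_pow {s : ℝ} (hs : 0 ≤ s) :
    s ^ ((5 : ℝ) / 2) = Real.sqrt s ^ 5 := by
  rw [Real.sqrt_eq_rpow, ← Real.rpow_natCast, ← Real.rpow_mul hs]
  norm_num

lemma hasDerivAt_sqrt_add_sq_add {Ψ : ℝ} (hΨ : 0 < Ψ) (x z : ℝ) :
    HasDerivAt (fun t => Real.sqrt (Ψ ^ 2 + t ^ 2 + z ^ 2))
      (x / Real.sqrt (Ψ ^ 2 + x ^ 2 + z ^ 2)) x := by
  have hS : 0 < Ψ ^ 2 + x ^ 2 + z ^ 2 := by positivity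
  have h := ((((hasDerivAt_id x).pow 2).const_add (Ψ ^ 2)).add_const (z ^ 2)).sqrt hS.ne'
  refine h.congr_deriv ?_
  have hR := Real.sqrt_pos.2 hS
  simp
  field_simp

lemma hasDerivAt_sqrt_add_add_sq {Ψ : ℝ} (hΨ : 0 < Ψ) (x z : ℝ) :
    HasDerivAt (fun t => Real.sqrt (Ψ ^ 2 + x ^ 2 + t ^ 2))
      (z / Real.sqrt (Ψ ^ 2 + x ^ 2 + z ^ 2)) z := by
  simpa only [add_right_comm] using hasDerivAt_sqrt_add_sq_add hΨ z x

lemma hasDerivAt_generalModelInner {Ψ : ℝ} (hΨ : 0 < Ψ) (x z : ℝ) :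
    HasDerivAt (fun t => generalModelInner Ψ t z)
      (Ψ * (Ψ ^ 2 + z ^ 2) / (Ψ ^ 2 + x ^ 2 + z ^ 2) ^ ((5 : ℝ) / 2)) x := by
  have hS : 0 < Ψ ^ 2 + x ^ 2 + z ^ 2 := by positivity
  have hB : 0 < Ψ ^ 2 + z ^ 2 := by positivity
  have hd := hasDerivAt_sqrt_add_sq_add hΨ x z
  rw [rpow_five_halves_eq_sqrt_pow hS.le]
  have hR := Real.sqrt_pos.2 hS
  have hsq := Real.sq_sqrt hS.le
  have h1 := ((hasDerivAt_id' x).const_mul Ψ).div ((hd.pow 3).const_mul 3)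
    (by simp only [Pi.pow_apply]; positivity)
  have h2 := ((hasDerivAt_id' x).const_mul (2 * Ψ)).div
    (hd.const_mul (3 * (Ψ ^ 2 + z ^ 2))) (by positivity)
  refine (h1.add h2).congr_deriv ?_
  simp only [Pi.pow_apply]
  generalize Real.sqrt (Ψ ^ 2 + x ^ 2 + z ^ 2) = R at *
  have hx : x ^ 2 = R ^ 2 - (Ψ ^ 2 + z ^ 2) := by linarith
  generalize Ψ ^ 2 + z ^ 2 = B at *
  push_cast
  field_simp
  simp only [hx]
  ring

lemma hasDerivAt_generalModelF {Ψ : ℝ} (hΨ : 0 < Ψ) (x z : ℝ) :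
    HasDerivAt (fun t => generalModelF Ψ x t) (generalModelInner Ψ x z) z := by
  have hS : 0 < Ψ ^ 2 + x ^ 2 + z ^ 2 := by positivity
  have hA : 0 < Ψ ^ 2 + x ^ 2 := by positivity
  have hB : 0 < Ψ ^ 2 + z ^ 2 := by positivity
  have hd := hasDerivAt_sqrt_add_add_sq hΨ x z
  have hR := Real.sqrt_pos.2 hS
  have hsq := Real.sq_sqrt hS.le
  have h1 := ((hasDerivAt_id' z).const_mul (Ψ * x)).div
    (hd.const_mul (3 * (Ψ ^ 2 + x ^ 2))) (by positivity)
  have h2 := ((((hasDerivAt_id' z).const_mul x).div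
    (hd.const_mul Ψ) (by positivity)).arctan).const_mul (2 / 3)
  refine (h1.add h2).congr_deriv ?_
  simp only [generalModelInner, Pi.div_apply]
  generalize Real.sqrt (Ψ ^ 2 + x ^ 2 + z ^ 2) = R at *
  have hz : R ^ 2 - z ^ 2 = Ψ ^ 2 + x ^ 2 := by linarith
  have e1 : (Ψ * x * 1 * (3 * (Ψ ^ 2 + x ^ 2) * R) -
      Ψ * x * z * (3 * (Ψ ^ 2 + x ^ 2) * (z / R))) / (3 * (Ψ ^ 2 + x ^ 2) * R) ^ 2 =
      Ψ * x / (3 * R ^ 3) := by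
    rw [← hz] at hA ⊢
    field_simp
  have e2 : 1 + (x * z / (Ψ * R)) ^ 2 =
      (Ψ ^ 2 + x ^ 2) * (Ψ ^ 2 + z ^ 2) / (Ψ ^ 2 * R ^ 2) := by
    field_simp
    rw [hsq]
    ring
  have e3 : (x * 1 * (Ψ * R) - x * z * (Ψ * (z / R))) / (Ψ * R) ^ 2 =
      x * (Ψ ^ 2 + x ^ 2) / (Ψ * R ^ 3) := by
    rw [← hz]
    field_simp
  rw [e1, e2, e3]
  field_simp

lemma continuous_generalModelInner {Ψ : ℝ} (hΨ : 0 < Ψ) (x : ℝ) :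
    Continuous (fun z => generalModelInner Ψ x z) := by
  unfold generalModelInner
  refine Continuous.add (Continuous.div (by fun_prop) (by fun_prop) fun z => ?_)
    (Continuous.div (by fun_prop) (by fun_prop) fun z => ?_) <;> positivity

lemma integral_generalModel_integrand {Ψ : ℝ} (hΨ : 0 < Ψ) (x₁ x₂ z : ℝ) :
    (∫ x in x₁..x₂, Ψ * (Ψ ^ 2 + z ^ 2) / (Ψ ^ 2 + x ^ 2 + z ^ 2) ^ ((5 : ℝ) / 2)) =
      generalModelInner Ψ x₂ z - generalModelInner Ψ x₁ z := by
  refine intervalIntegral.integral_eq_sub_of_hasDerivAt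
    (fun x _ => hasDerivAt_generalModelInner hΨ x z) (Continuous.intervalIntegrable ?_ _ _)
  refine Continuous.div continuous_const
    (Continuous.rpow_const (by fun_prop) fun x => Or.inr (by norm_num)) fun x => ?_
  positivity

lemma integral_generalModelInner {Ψ : ℝ} (hΨ : 0 < Ψ) (x z₁ z₂ : ℝ) :
    (∫ z in z₁..z₂, generalModelInner Ψ x z) =
      generalModelF Ψ x z₂ - generalModelF Ψ x z₁ :=
  intervalIntegral.integral_eq_sub_of_hasDerivAt
    (fun z _ => hasDerivAt_generalModelF hΨ x z)
    ((continuous_generalModelInner hΨ x).intervalIntegrable _ _)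

/-- Closed-form evaluation of the double integral underlying the received SNR of the
general near-field channel model: for `x₁ ≤ x₂`, `z₁ ≤ z₂`,
`∫∫ Ψ(Ψ² + z²)/(Ψ² + x² + z²)^{5/2} dx dz = F(x₂,z₂) − F(x₁,z₂) − F(x₂,z₁) + F(x₁,z₁)`. -/
theorem general_model_double_integral (Ψ : ℝ) (hΨ : 0 < Ψ)
    (x₁ x₂ z₁ z₂ : ℝ) (hx : x₁ ≤ x₂) (hz : z₁ ≤ z₂) :
    (∫ z in z₁..z₂, ∫ x in x₁..x₂,
        Ψ * (Ψ ^ 2 + z ^ 2) / (Ψ ^ 2 + x ^ 2 + z ^ 2) ^ ((5 : ℝ) / 2)) =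
      generalModelF Ψ x₂ z₂ - generalModelF Ψ x₁ z₂
        - generalModelF Ψ x₂ z₁ + generalModelF Ψ x₁ z₁ := by
  simp only [integral_generalModel_integrand hΨ]
  rw [intervalIntegral.integral_sub
    ((continuous_generalModelInner hΨ x₂).intervalIntegrable _ _)
    ((continuous_generalModelInner hΨ x₁).intervalIntegrable _ _),
    integral_generalModelInner hΨ, integral_generalModelInner hΨ]
  ring
end

section
/- For all a > 0 and b > 0, the function x ↦ (1/√(ab))·arctan( √b·x / ( √a·√(x² + a + b) ) ) is differentiable on ℝ and its derivative at every x ∈ ℝ equals 1/( (x² + a)·√(x² + a + b) ). -/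
/-- Antiderivative identity used for the general near-field channel model:
for `a, b > 0`, the function `x ↦ (1/√(ab))·arctan(√b·x/(√a·√(x² + a + b)))` is
differentiable everywhere with derivative `1/((x² + a)·√(x² + a + b))`. -/
theorem arctan_antiderivative (a b : ℝ) (ha : 0 < a) (hb : 0 < b) (x : ℝ) :
    HasDerivAt
      (fun x : ℝ =>
        (1 / Real.sqrt (a * b)) *
          Real.arctan (Real.sqrt b * x / (Real.sqrt a * Real.sqrt (x ^ 2 + a + b))))
      (1 / ((x ^ 2 + a) * Real.sqrt (x ^ 2 + a + b))) x := by
  have hc : 0 < x ^ 2 + a + b := by positivity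
  have hden : √a * √(x ^ 2 + a + b) ≠ 0 := by positivity
  have hsqrt : HasDerivAt (fun y : ℝ => √(y ^ 2 + a + b)) (2 * x / (2 * √(x ^ 2 + a + b))) x := by
    simpa using ((((hasDerivAt_id x).pow 2).add_const a).add_const b).sqrt hc.ne'
  have harg := ((hasDerivAt_id' x).const_mul √b).fun_div (hsqrt.const_mul √a) hden
  refine (harg.arctan.const_mul (1 / √(a * b))).congr_deriv ?_
  rw [Real.sqrt_mul ha.le]
  have hp : 0 < √a := Real.sqrt_pos.2 ha
  have hq : 0 < √b := Real.sqrt_pos.2 hb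
  have hS : 0 < √(x ^ 2 + a + b) := Real.sqrt_pos.2 hc
  have hp2 : √a ^ 2 = a := Real.sq_sqrt ha.le
  have hq2 : √b ^ 2 = b := Real.sq_sqrt hb.le
  have hS2 : √(x ^ 2 + a + b) ^ 2 = x ^ 2 + a + b := Real.sq_sqrt hc.le
  generalize √(x ^ 2 + a + b) = S at *
  have hfactor : 1 + (√b * x / (√a * S)) ^ 2 = (a + b) * (x ^ 2 + a) / (a * S ^ 2) := by
    rw [div_pow, mul_pow, mul_pow, hp2, hq2, hS2]
    field_simp
    ring
  have hnum : (√b * 1 * (√a * S) - √b * x * (√a * (2 * x / (2 * S)))) / (√a * S) ^ 2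
      = √a * √b * (a + b) / (a * S ^ 3) := by
    rw [mul_pow, hp2]
    field_simp
    linear_combination hS2
  rw [hfactor, hnum]
  have hxa : 0 < x ^ 2 + a := by positivity
  field_simp
end

section
/- Let Ψ > 0, Φ, Ω ∈ ℝ, and let F_Ψ(x, z) = Ψxz/( 3(Ψ² + x²)·√(Ψ² + x² + z²) ) + (2/3)·arctan( xz/( Ψ·√(Ψ² + x² + z²) ) ). Then, along the product filter atTop ×ˢ atTop in (a, b), F_Ψ(a−Φ, b−Ω) + F_Ψ(a−Φ, b+Ω) + F_Ψ(a+Φ, b−Ω) + F_Ψ(a+Φ, b+Ω) tends to 4π/3. Consequently, for any constants p, σ², A, e_a, d > 0, the approximate received SNR (pAe_a/(4πd²σ²)) times this four-corner sum converges to the finite limit pAe_a/(3σ²d²) as the array dimensions grow without bound. -/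
/-- The four-corner sum of `F_Ψ` corresponding to the array aperture. -/
noncomputable def fourCornerSum (Ψ Φ Ω : ℝ) (q : ℝ × ℝ) : ℝ :=
  generalModelF Ψ (q.1 - Φ) (q.2 - Ω) + generalModelF Ψ (q.1 - Φ) (q.2 + Ω) +
    generalModelF Ψ (q.1 + Φ) (q.2 - Ω) + generalModelF Ψ (q.1 + Φ) (q.2 + Ω)

open Filter Topology

theorem tendsto_mul_div_sqrt_atTop {Ψ : ℝ} (hΨ : 0 < Ψ) :
    Tendsto (fun q : ℝ × ℝ => q.1 * q.2 / (Ψ * √(Ψ ^ 2 + q.1 ^ 2 + q.2 ^ 2)))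
      (atTop ×ˢ atTop) atTop := by
  refine tendsto_atTop.2 fun b => ?_
  set M := max Ψ (3 * Ψ * b) with hM
  have hΨM : Ψ ≤ M := le_max_left _ _
  have hbM : 3 * Ψ * b ≤ M := le_max_right _ _
  filter_upwards [prod_mem_prod (Ici_mem_atTop M) (Ici_mem_atTop M)] with q hq
  obtain ⟨x, z⟩ := q
  obtain ⟨hx, hz⟩ : M ≤ x ∧ M ≤ z := hq
  have hM0 : 0 < M := hΨ.trans_le hΨM
  have hS0 : 0 < √(Ψ ^ 2 + x ^ 2 + z ^ 2) := by positivity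
  have hS : √(Ψ ^ 2 + x ^ 2 + z ^ 2) ≤ x + z + M :=
    Real.sqrt_le_iff.2 ⟨by linarith, by
      nlinarith [mul_nonneg (hM0.le.trans hx) (hM0.le.trans hz),
        mul_nonneg hM0.le (hM0.le.trans hx), mul_nonneg hM0.le (hM0.le.trans hz)]⟩
  change b ≤ x * z / (Ψ * √(Ψ ^ 2 + x ^ 2 + z ^ 2))
  rw [le_div_iff₀ (by positivity)]
  have hxz : M * (x + z + M) ≤ 3 * (x * z) := by
    nlinarith [mul_nonneg (sub_nonneg.2 hx) (sub_nonneg.2 hz),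
      mul_nonneg hM0.le (sub_nonneg.2 hx), mul_nonneg hM0.le (sub_nonneg.2 hz)]
  have h₁ := mul_le_mul_of_nonneg_right hbM hS0.le
  have h₂ := mul_le_mul_of_nonneg_left hS hM0.le
  linarith

theorem tendsto_rational_part_zero {Ψ : ℝ} (hΨ : 0 < Ψ) :
    Tendsto (fun q : ℝ × ℝ =>
        Ψ * q.1 * q.2 / (3 * (Ψ ^ 2 + q.1 ^ 2) * √(Ψ ^ 2 + q.1 ^ 2 + q.2 ^ 2)))
      (atTop ×ˢ atTop) (𝓝 0) := by
  have hlim : Tendsto (fun q : ℝ × ℝ => Ψ / q.1) (atTop ×ˢ atTop) (𝓝 0) :=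
    tendsto_fst.const_div_atTop Ψ
  have hpos := prod_mem_prod (Ioi_mem_atTop (0 : ℝ)) (Ioi_mem_atTop (0 : ℝ))
  refine tendsto_of_tendsto_of_tendsto_of_le_of_le' tendsto_const_nhds hlim ?_ ?_
  · filter_upwards [hpos] with q ⟨hx, hz⟩
    have hx : 0 < q.1 := hx
    have hz : 0 < q.2 := hz
    positivity
  · filter_upwards [hpos] with ⟨x, z⟩ ⟨hx, hz⟩
    have hx : 0 < x := hx
    have hz : 0 < z := hz
    have hzS : z ≤ √(Ψ ^ 2 + x ^ 2 + z ^ 2) := Real.le_sqrt_of_sq_le (by nlinarith)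
    change Ψ * x * z / (3 * (Ψ ^ 2 + x ^ 2) * √(Ψ ^ 2 + x ^ 2 + z ^ 2)) ≤ Ψ / x
    rw [div_le_div_iff₀ (by positivity) hx]
    calc Ψ * x * z * x = Ψ * (x ^ 2 * z) := by ring
      _ ≤ Ψ * (3 * (Ψ ^ 2 + x ^ 2) * √(Ψ ^ 2 + x ^ 2 + z ^ 2)) := by
        gcongr
        nlinarith [sq_nonneg Ψ, sq_nonneg x]

theorem tendsto_generalModelF {Ψ : ℝ} (hΨ : 0 < Ψ) :
    Tendsto (fun q : ℝ × ℝ => generalModelF Ψ q.1 q.2) (atTop ×ˢ atTop)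
      (𝓝 (Real.pi / 3)) := by
  have harctan : Tendsto Real.arctan atTop (𝓝 (Real.pi / 2)) :=
    Real.tendsto_arctan_atTop.mono_right nhdsWithin_le_nhds
  have h := (tendsto_rational_part_zero hΨ).add
    ((harctan.comp (tendsto_mul_div_sqrt_atTop hΨ)).const_mul (2 / 3))
  rwa [show 0 + 2 / 3 * (Real.pi / 2) = Real.pi / 3 by ring] at h

theorem tendsto_generalModelF_add {Ψ : ℝ} (hΨ : 0 < Ψ) (u v : ℝ) :
    Tendsto (fun q : ℝ × ℝ => generalModelF Ψ (q.1 + u) (q.2 + v)) (atTop ×ˢ atTop)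
      (𝓝 (Real.pi / 3)) :=
  (tendsto_generalModelF hΨ).comp
    ((tendsto_atTop_add_const_right _ u tendsto_id).prodMap
      (tendsto_atTop_add_const_right _ v tendsto_id))

theorem tendsto_fourCornerSum {Ψ : ℝ} (hΨ : 0 < Ψ) (Φ Ω : ℝ) :
    Tendsto (fourCornerSum Ψ Φ Ω) (atTop ×ˢ atTop) (𝓝 (4 * Real.pi / 3)) := by
  have h := (((tendsto_generalModelF_add hΨ (-Φ) (-Ω)).add
    (tendsto_generalModelF_add hΨ (-Φ) Ω)).add
    (tendsto_generalModelF_add hΨ Φ (-Ω))).add (tendsto_generalModelF_add hΨ Φ Ω)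
  rw [show Real.pi / 3 + Real.pi / 3 + Real.pi / 3 + Real.pi / 3 = 4 * Real.pi / 3 by ring] at h
  simp only [← sub_eq_add_neg] at h
  exact h

/-- Asymptotic SNR of the general near-field channel model: the four-corner sum tends to
`4π/3` as the array dimensions grow without bound, and consequently the approximate
received SNR `(pAe_a/(4πd²σ²))·(four-corner sum)` converges to the finite limit
`pAe_a/(3σ²d²)`, in accordance with the law of conservation of energy. -/
theorem general_model_snr_limit (Ψ Φ Ω : ℝ) (hΨ : 0 < Ψ)
    (p σ2 A ea d : ℝ) (hp : 0 < p) (hσ : 0 < σ2) (hA : 0 < A) (hea : 0 < ea)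
    (hd : 0 < d) :
    Filter.Tendsto (fun q : ℝ × ℝ => fourCornerSum Ψ Φ Ω q)
      (Filter.atTop ×ˢ Filter.atTop) (nhds (4 * Real.pi / 3)) ∧
    Filter.Tendsto
      (fun q : ℝ × ℝ => p * A * ea / (4 * Real.pi * d ^ 2 * σ2) * fourCornerSum Ψ Φ Ω q)
      (Filter.atTop ×ˢ Filter.atTop) (nhds (p * A * ea / (3 * σ2 * d ^ 2))) := by
  have h := tendsto_fourCornerSum hΨ Φ Ω
  refine ⟨h, ?_⟩
  convert h.const_mul (p * A * ea / (4 * Real.pi * d ^ 2 * σ2)) using 2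
  field_simp
end

section
/- Let r ≥ 1 be an integer, let λ₁, …, λ_r be positive reals with λ_min = min_j λ_j, and define the Moschopoulos coefficients by ψ₀ = 1 and ψ_{k+1} = (1/(k+1))·Σ_{i=1}^{k+1} ( Σ_{j=1}^{r} (1 − λ_min/λ_j)^i )·ψ_{k+1−i} for k ≥ 0. Then for every s ≥ 0 the series Σ_{k=0}^{∞} ψ_k·(1 + λ_min s)^{−(r+k)} converges and (λ_min^r / ∏_{j=1}^{r} λ_j)·Σ_{k=0}^{∞} ψ_k·(1 + λ_min s)^{−(r+k)} = ∏_{j=1}^{r} (1 + λ_j s)^{−1}. -/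
/-- The Moschopoulos coefficients `ψ_k` determined by the weight sequence
`b i = Σ_j (1 − λ_min/λ_j)^i`: `ψ₀ = 1` and
`ψ_{k+1} = (1/(k+1))·Σ_{i=1}^{k+1} b i · ψ_{k+1−i}`
(written below with `j = k + 1 − i`). -/
noncomputable def moschopoulos (b : ℕ → ℝ) : ℕ → ℝ
  | 0 => 1
  | k + 1 => (1 / ((k : ℝ) + 1)) *
      ∑ j : Fin (k + 1), b (k + 1 - (j : ℕ)) * moschopoulos b (j : ℕ)
  termination_by n => n
  decreasing_by exact j.isLt
namespace Moschopoulos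

open PowerSeries Finset

/-- A power series with constant term `1` whose logarithmic derivative has coefficients
`b 1, b 2, …` has the Moschopoulos coefficients of `b` as its coefficients. -/
theorem coeff_eq_of_derivative {b : ℕ → ℝ} {G : PowerSeries ℝ} (h0 : coeff 0 G = 1)
    (hG : derivative ℝ G = G * PowerSeries.mk fun i => b (i + 1)) (k : ℕ) :
    coeff k G = moschopoulos b k := by
  induction k using Nat.strong_induction_on with
  | _ k ih =>
    cases k with
    | zero => rw [h0, moschopoulos]
    | succ k =>
      have h := congrArg (coeff k) hG
      rw [coeff_derivative, coeff_mul,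
        Finset.Nat.sum_antidiagonal_eq_sum_range_succ_mk] at h
      rw [moschopoulos, Fin.sum_univ_eq_sum_range
        (fun j => b (k + 1 - j) * moschopoulos b j) (k + 1)]
      have hk : (k : ℝ) + 1 ≠ 0 := by positivity
      rw [one_div, eq_inv_mul_iff_mul_eq₀ hk, mul_comm, h]
      refine Finset.sum_congr rfl fun j hj => ?_
      have hj' : j < k + 1 := Finset.mem_range.mp hj
      rw [coeff_mk, ih j hj', mul_comm, Nat.sub_add_comm (Nat.lt_succ_iff.mp hj')]

theorem derivative_geometric (c : ℝ) :
    derivative ℝ (PowerSeries.mk fun n => c ^ n) =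
      (PowerSeries.mk fun n => c ^ n) * PowerSeries.mk fun n => c ^ (n + 1) := by
  ext n
  have h : ∀ p ∈ antidiagonal n, c ^ p.1 * c ^ (p.2 + 1) = c ^ (n + 1) := fun p hp => by
    rw [← pow_add, ← add_assoc, mem_antidiagonal.mp hp]
  simp only [coeff_derivative, coeff_mul, coeff_mk]
  rw [Finset.sum_congr rfl h]
  simp [mul_comm]

theorem derivative_prod_geometric {ι : Type*} (t : Finset ι) (c : ι → ℝ) :
    derivative ℝ (∏ j ∈ t, PowerSeries.mk fun n => c j ^ n) =
      (∏ j ∈ t, PowerSeries.mk fun n => c j ^ n) *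
        PowerSeries.mk fun n => ∑ j ∈ t, c j ^ (n + 1) := by
  classical
  induction t using Finset.induction_on with
  | empty =>
    have h : (PowerSeries.mk fun _ => (0 : ℝ)) = 0 := by ext; simp
    simp [h]
  | insert a t ha ih =>
    have h : (PowerSeries.mk fun n => ∑ j ∈ insert a t, c j ^ (n + 1)) =
        (PowerSeries.mk fun n => c a ^ (n + 1)) +
          PowerSeries.mk fun n => ∑ j ∈ t, c j ^ (n + 1) := by
      ext n
      simp [Finset.sum_insert ha]
    rw [Finset.prod_insert ha, Derivation.leibniz, ih, derivative_geometric, h]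
    simp only [smul_eq_mul]
    ring

theorem coeff_prod_geometric {ι : Type*} (t : Finset ι) (c : ι → ℝ) (k : ℕ) :
    coeff k (∏ j ∈ t, PowerSeries.mk fun n => c j ^ n) =
      moschopoulos (fun i => ∑ j ∈ t, c j ^ i) k :=
  coeff_eq_of_derivative (by simp [map_prod, ← coeff_zero_eq_constantCoeff_apply])
    (derivative_prod_geometric t c) k

theorem summable_norm_and_tsum_prod_geometric {ι : Type*} (t : Finset ι) (c : ι → ℝ) (x : ℝ)
    (hc : ∀ j ∈ t, |c j * x| < 1) :
    Summable (fun k => ‖coeff k (∏ j ∈ t, PowerSeries.mk fun n => c j ^ n) * x ^ k‖) ∧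
      ∑' k, coeff k (∏ j ∈ t, PowerSeries.mk fun n => c j ^ n) * x ^ k =
        ∏ j ∈ t, (1 - c j * x)⁻¹ := by
  classical
  induction t using Finset.induction_on with
  | empty =>
    have h : ∀ k ≠ 0, coeff k (1 : PowerSeries ℝ) * x ^ k = 0 := fun k hk => by
      simp [coeff_one, hk]
    refine ⟨summable_of_ne_finset_zero (s := {0}) fun k hk => ?_, ?_⟩
    · rw [Finset.prod_empty, h k (by simpa using hk), norm_zero]
    · rw [Finset.prod_empty, Finset.prod_empty, tsum_eq_single 0 h]
      simp
  | insert a t ha ih =>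
    obtain ⟨hs, ht⟩ := ih fun j hj => hc j (mem_insert_of_mem hj)
    have hca := hc a (mem_insert_self a t)
    have hg : Summable fun n => ‖(c a * x) ^ n‖ := by
      simpa only [norm_pow] using
        summable_geometric_of_lt_one (norm_nonneg _) (by rwa [Real.norm_eq_abs])
    set g : ℕ → ℝ := fun k => coeff k (∏ j ∈ t, PowerSeries.mk fun n => c j ^ n) * x ^ k with g_def
    have key : ∀ k, coeff k (∏ j ∈ insert a t, PowerSeries.mk fun n => c j ^ n) * x ^ k =
        ∑ p ∈ antidiagonal k, (c a * x) ^ p.1 * g p.2 := fun k => by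
      rw [Finset.prod_insert ha, coeff_mul, Finset.sum_mul]
      refine Finset.sum_congr rfl fun p hp => ?_
      rw [coeff_mk, ← mem_antidiagonal.mp hp, g_def]
      ring
    simp only [key]
    rw [Finset.prod_insert ha, ← tsum_geometric_of_abs_lt_one hca, ← ht]
    change Summable fun k => ‖g k‖ at hs
    clear_value g
    exact ⟨summable_norm_sum_mul_antidiagonal_of_summable_norm hg hs,
      (tsum_mul_tsum_eq_tsum_sum_antidiagonal_of_summable_norm hg hs).symm⟩

/-- The generating function of the Moschopoulos coefficients of the power sums of `c`. -/
theorem hasSum_prod_geometric {ι : Type*} (t : Finset ι) (c : ι → ℝ) (x : ℝ)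
    (hc : ∀ j ∈ t, |c j * x| < 1) :
    HasSum (fun k => moschopoulos (fun i => ∑ j ∈ t, c j ^ i) k * x ^ k)
      (∏ j ∈ t, (1 - c j * x)⁻¹) := by
  obtain ⟨hs, ht⟩ := summable_norm_and_tsum_prod_geometric t c x hc
  have h := hs.of_norm.hasSum
  rw [ht] at h
  simpa only [coeff_prod_geometric] using h

end Moschopoulos

/-- Moschopoulos series identity: for positive weights `λ₁, …, λ_r` with minimum `λ_min`
and every `s ≥ 0`, the series `Σ_k ψ_k·(1 + λ_min s)^{−(r+k)}` converges and
`(λ_min^r / ∏_j λ_j) · Σ_k ψ_k·(1 + λ_min s)^{−(r+k)} = ∏_j (1 + λ_j s)⁻¹`. -/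
theorem moschopoulos_laplace_transform (r : ℕ) (hr : 1 ≤ r)
    (lam : Fin r → ℝ) (hlam : ∀ j, 0 < lam j)
    (lmin : ℝ) (hmin : IsLeast (Set.range lam) lmin) (s : ℝ) (hs : 0 ≤ s) :
    Summable (fun k : ℕ =>
      moschopoulos (fun i => ∑ j, (1 - lmin / lam j) ^ i) k / (1 + lmin * s) ^ (r + k)) ∧
    (lmin ^ r / ∏ j, lam j) *
        ∑' k : ℕ,
          moschopoulos (fun i => ∑ j, (1 - lmin / lam j) ^ i) k / (1 + lmin * s) ^ (r + k)
      = ∏ j, (1 + lam j * s)⁻¹ := by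
  obtain ⟨⟨j₀, rfl⟩, hle⟩ := hmin
  set m := lam j₀
  have hm : 0 < m := hlam j₀
  have hd : 0 < 1 + m * s := by positivity
  have hc : ∀ j ∈ Finset.univ, |(1 - m / lam j) * (1 + m * s)⁻¹| < 1 := fun j _ => by
    have h1 : m / lam j ≤ 1 := (div_le_one (hlam j)).mpr (hle ⟨j, rfl⟩)
    have h2 : 0 < m / lam j := div_pos hm (hlam j)
    have h3 : (1 + m * s)⁻¹ ≤ 1 := inv_le_one_of_one_le₀ (by nlinarith)
    have h4 : 0 < (1 + m * s)⁻¹ := inv_pos.mpr hd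
    rw [abs_of_nonneg (mul_nonneg (by linarith) h4.le)]
    nlinarith
  have hsum := (Moschopoulos.hasSum_prod_geometric Finset.univ (fun j => 1 - m / lam j)
    (1 + m * s)⁻¹ hc).mul_left ((1 + m * s)⁻¹ ^ r)
  have hterm : ∀ k, (1 + m * s)⁻¹ ^ r *
      (moschopoulos (fun i => ∑ j, (1 - m / lam j) ^ i) k * (1 + m * s)⁻¹ ^ k) =
      moschopoulos (fun i => ∑ j, (1 - m / lam j) ^ i) k / (1 + m * s) ^ (r + k) := fun k => by
    rw [div_eq_mul_inv, ← inv_pow, pow_add]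
    ring
  simp only [hterm] at hsum
  refine ⟨hsum.summable, ?_⟩
  have hconst : ∀ a : ℝ, a ^ r = ∏ _j : Fin r, a := fun a => by simp
  rw [hsum.tsum_eq, hconst m, hconst (1 + m * s)⁻¹, ← Finset.prod_div_distrib,
    ← Finset.prod_mul_distrib, ← Finset.prod_mul_distrib]
  refine Finset.prod_congr rfl fun j _ => ?_
  have hj := hlam j
  have hjs : 0 < 1 + lam j * s := by positivity
  have h : 1 - (1 - m / lam j) * (1 + m * s)⁻¹ =
      m * (1 + lam j * s) / (lam j * (1 + m * s)) := by
    field_simp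
    ring
  rw [h]
  field_simp
end
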